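/- arXiv:2511.10409 — 9 statements merged into one kernel-verified Lean document; each statement's English description precedes it below -/
import Mathlib

section
/- Assume the DAG hypothesis. If a appears before b in the trace L i of some agent i, then ¬ Relation.TransGen R b a. (Equivalently: a cycle would arise in the summarization if the diagram ordered any two tasks of one agent oppositely to that agent's trace; this is the core of the correctness proof of Theorem 1.) -/
/-- If `R` holds between consecutive entries of a list, then its transitive closure
relates every entry to each later one. -/
theorem transGen_of_infix_pairs {α : Type*} {R : α → α → Prop} {l : List α}
    (h : ∀ x y, [x, y] <:+: l → R x y) {a b : α} {l₁ l₂ l₃ : List α}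
    (hl : l = l₁ ++ a :: l₂ ++ b :: l₃) : Relation.TransGen R a b := by
  induction l₂ generalizing a l₁ with
  | nil => exact .single (h a b ⟨l₁, l₃, by simp [hl]⟩)
  | cons c l₂ ih =>
    exact .head (h a c ⟨l₁, l₂ ++ b :: l₃, by simp [hl]⟩)
      (ih (l₁ := l₁ ++ [a]) (by simp [hl]))

/-- Under the DAG hypothesis, if `a` appears before `b` in some
agent's trace, then there is no `TransGen R` path from `b` back to `a`. -/
theorem stmt1 {α : Type*} [DecidableEq α] {N : ℕ} (L : Fin N → List α)
    (hnd : ∀ i, (L i).Nodup)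
    (R : α → α → Prop)
    (hR : ∀ a b, R a b ↔ ∃ i, [a, b] <:+: L i)
    (hdag : Irreflexive (Relation.TransGen R))
    (i : Fin N) (a b : α)
    (hab : ∃ l₁ l₂ l₃, L i = l₁ ++ a :: l₂ ++ b :: l₃) :
    ¬ Relation.TransGen R b a := by
  obtain ⟨l₁, l₂, l₃, hl⟩ := hab
  intro hba
  exact hdag b (hba.trans
    (transGen_of_infix_pairs (fun x y hxy => (hR x y).mpr ⟨i, hxy⟩) hl))
end

section
/- (Correctness part of Theorem 1.) Assume the DAG hypothesis. Then for every R-path, its projection onto any agent conforms to that agent's trace: for every list p with List.Chain' R p and every agent i, the list p.filter (· ∈ L i) is a sublist (order-preserving subsequence, List.Sublist) of L i. -/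
theorem List.IsChain.pairwise_transGen {α : Type*} {R : α → α → Prop} {l : List α}
    (h : l.IsChain R) : l.Pairwise (Relation.TransGen R) :=
  (h.imp fun _ _ => Relation.TransGen.single).pairwise

/-- Correctness part of Theorem 1: Under the DAG hypothesis,
every `R`-path's projection onto agent `i` is a sublist of `L i`. -/
theorem stmt4 {α : Type*} [DecidableEq α] {N : ℕ} (L : Fin N → List α)
    (hnd : ∀ i, (L i).Nodup)
    (R : α → α → Prop)
    (hR : ∀ a b, R a b ↔ ∃ i, [a, b] <:+: L i)
    (hdag : Irreflexive (Relation.TransGen R)) :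
    ∀ p : List α, List.Chain' R p → ∀ i : Fin N,
      (p.filter (· ∈ L i)).Sublist (L i) := by
  intro p hp i
  have hL : (L i).IsChain R :=
    List.isChain_iff_forall_rel_of_append_cons_cons.2 fun {a b l₁ l₂} h =>
      (hR a b).2 ⟨i, l₁, l₂, by simp [h]⟩
  have hpw : p.Pairwise (Relation.TransGen R) := List.IsChain.pairwise_transGen hp
  have hpnd : p.Nodup := hpw.imp fun h hab => by subst hab; exact hdag _ h
  have : Std.Antisymm (Relation.TransGen R) := ⟨fun a b h₁ h₂ => (hdag a (h₁.trans h₂)).elim⟩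
  refine List.sublist_of_subperm_of_pairwise ?_ (hpw.filter _) hL.pairwise_transGen
  exact (hpnd.filter _).subperm fun a ha => by simpa using (List.mem_filter.1 ha).2
end

section
/- Assume the DAG hypothesis. If the two-element list [a, b] occurs as a contiguous sublist of the trace L i of some agent i, then no element of L i lies strictly between a and b in the summarization order: there is no c with c ∈ L i, Relation.TransGen R a c, and Relation.TransGen R c b. -/
/-- If every consecutive pair of `l` is related by `R`, then earlier elements of `l` are related
to later ones by the transitive closure of `R`. -/
theorem List.pairwise_transGen_of_infix {α : Type*} {R : α → α → Prop} {l : List α}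
    (h : ∀ a b, [a, b] <:+: l → R a b) : l.Pairwise (Relation.TransGen R) := by
  rw [← List.isChain_iff_pairwise, List.isChain_iff_forall_rel_of_append_cons_cons]
  rintro a b s t rfl
  exact .single (h a b ⟨s, t, by simp⟩)

/-- Under the DAG hypothesis, if `[a, b]` is an infix of `L i`,
then no element of `L i` lies strictly between `a` and `b` in the
summarization order. -/
theorem stmt5 {α : Type*} [DecidableEq α] {N : ℕ} (L : Fin N → List α)
    (hnd : ∀ i, (L i).Nodup)
    (R : α → α → Prop)
    (hR : ∀ a b, R a b ↔ ∃ i, [a, b] <:+: L i)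
    (hdag : Irreflexive (Relation.TransGen R))
    (i : Fin N) (a b : α) (hab : [a, b] <:+: L i) :
    ¬ ∃ c, c ∈ L i ∧ Relation.TransGen R a c ∧ Relation.TransGen R c b := by
  rintro ⟨c, hc, hac, hcb⟩
  have hp : (L i).Pairwise (Relation.TransGen R) :=
    List.pairwise_transGen_of_infix fun x y h => (hR x y).2 ⟨i, h⟩
  obtain ⟨s, t, hst⟩ := hab
  rw [← hst] at hc hp
  simp only [List.mem_append, List.mem_cons, List.not_mem_nil, or_false] at hc
  rw [List.append_assoc, List.pairwise_append] at hp
  obtain ⟨-, hp, hs⟩ := hp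
  rw [List.pairwise_append] at hp
  rcases hc with (hc | rfl | rfl) | hc
  · exact hdag a (hac.trans (hs c hc a (by simp)))
  · exact hdag c hac
  · exact hdag c hcb
  · exact hdag b ((hp.2.2 b (by simp) c hc).trans hcb)
end

section
/- (Completeness part of Theorem 1, preserved under transitive reduction.) Assume the DAG hypothesis, and let R' be any transitive reduction of R. Then for every agent i there exists an R'-path realizing exactly agent i's trace: there is a list p with List.Chain' R' p such that p.filter (· ∈ L i) = L i. -/
/-- A transitive step unfolds to a path whose interior vertices lie strictly between its ends. -/
theorem exists_isChain_of_transGen {α : Type*} {r : α → α → Prop} {a b : α}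
    (h : Relation.TransGen r a b) :
    ∃ m : List α, (∀ c ∈ m, Relation.TransGen r a c ∧ Relation.TransGen r c b) ∧
      ∀ q : List α, List.IsChain r (b :: q) → List.IsChain r (a :: (m ++ b :: q)) := by
  induction h using Relation.TransGen.head_induction_on with
  | single h => exact ⟨[], by simp, fun q hq => List.isChain_cons_cons.2 ⟨h, hq⟩⟩
  | @head a c hac hcb ih =>
    obtain ⟨m, hm, hchain⟩ := ih
    refine ⟨c :: m, fun d hd => ?_, fun q hq => List.isChain_cons_cons.2 ⟨hac, hchain q hq⟩⟩
    rcases List.mem_cons.1 hd with rfl | hd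
    · exact ⟨.single hac, hcb⟩
    · exact ⟨.head hac (hm d hd).1, (hm d hd).2⟩

/-- A list in `S` whose consecutive elements are linked by `r`-paths, with no element of `S`
strictly between them, is the restriction to `S` of an `r`-path. -/
theorem exists_isChain_filter_eq {α : Type*} [DecidableEq α] {r : α → α → Prop} (S : List α)
    (x : α) (l : List α) (hS : x :: l ⊆ S)
    (hl : List.IsChain (fun a b => Relation.TransGen r a b ∧
      ∀ c ∈ S, Relation.TransGen r a c → ¬ Relation.TransGen r c b) (x :: l)) :
    ∃ p : List α, List.IsChain r (x :: p) ∧ (x :: p).filter (· ∈ S) = x :: l := by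
  induction l generalizing x with
  | nil => exact ⟨[], by simp, by simpa using hS⟩
  | cons y l ih =>
    obtain ⟨⟨hxy, hbetween⟩, hl⟩ := List.isChain_cons_cons.1 hl
    obtain ⟨hx, hS⟩ := List.cons_subset.1 hS
    obtain ⟨p, hp, hfilter⟩ := ih y hS hl
    obtain ⟨m, hm, hchain⟩ := exists_isChain_of_transGen hxy
    refine ⟨m ++ y :: p, hchain p hp, ?_⟩
    have hm' : m.filter (· ∈ S) = [] := by
      simp only [List.filter_eq_nil_iff, decide_eq_true_eq]
      exact fun c hc hcS => hbetween c hcS (hm c hc).1 (hm c hc).2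
    rw [List.filter_cons_of_pos (by simpa using hx), List.filter_append, hm', hfilter,
      List.nil_append]

/-- Completeness part of Theorem 1, preserved under transitive
reduction: Under the DAG hypothesis, for any transitive reduction `R'` of `R`
and any agent `i`, there is an `R'`-path realizing exactly `L i`. -/
theorem stmt6 {α : Type*} [DecidableEq α] {N : ℕ} (L : Fin N → List α)
    (hnd : ∀ i, (L i).Nodup)
    (R : α → α → Prop)
    (hR : ∀ a b, R a b ↔ ∃ i, [a, b] <:+: L i)
    (hdag : Irreflexive (Relation.TransGen R))
    (R' : α → α → Prop) (hle : R' ≤ R)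
    (hcl : Relation.ReflTransGen R' = Relation.ReflTransGen R) :
    ∀ i : Fin N, ∃ p : List α, List.Chain' R' p ∧ p.filter (· ∈ L i) = L i := by
  intro i
  have htrans : ∀ {a b}, Relation.TransGen R' a b → Relation.TransGen R a b :=
    fun h => Relation.TransGen.mono hle _ _ h
  have hstep : ∀ {a b}, R a b → Relation.TransGen R' a b := by
    intro a b hab
    have h : Relation.ReflTransGen R' a b := hcl ▸ Relation.ReflTransGen.single hab
    rcases Relation.reflTransGen_iff_eq_or_transGen.1 h with rfl | h
    · exact (hdag _ (.single hab)).elim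
    · exact h
  have hchain : List.IsChain (Relation.TransGen R') (L i) :=
    List.isChain_iff_forall_rel_of_append_cons_cons.2 fun a b s t h =>
      hstep ((hR a b).2 ⟨i, s, t, by simp [h]⟩)
  have hpair := hchain.pairwise
  have hgap : List.IsChain (fun a b => Relation.TransGen R' a b ∧
      ∀ c ∈ L i, Relation.TransGen R' a c → ¬ Relation.TransGen R' c b) (L i) := by
    refine List.isChain_iff_forall_rel_of_append_cons_cons.2 fun {a b s t} h => ?_
    have hirr : ∀ x, ¬ Relation.TransGen R' x x := fun x hx => hdag x (htrans hx)
    rw [h] at hpair ⊢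
    simp only [List.pairwise_append, List.pairwise_cons, List.mem_cons] at hpair
    obtain ⟨-, ⟨ha, hb, -⟩, hs⟩ := hpair
    refine ⟨ha b (.inl rfl), fun c hc hac hcb => ?_⟩
    simp only [List.mem_append, List.mem_cons] at hc
    rcases hc with hc | rfl | rfl | hc
    · exact hirr a (hac.trans (hs c hc a (.inl rfl)))
    · exact hirr _ hac
    · exact hirr _ hcb
    · exact hirr b ((hb c hc).trans hcb)
  rcases hLi : L i with _ | ⟨x, l⟩
  · exact ⟨[], .nil, by simp⟩
  · rw [hLi] at hgap
    obtain ⟨p, hp, hfilter⟩ := exists_isChain_filter_eq (x :: l) x l (List.Subset.refl _) hgap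
    exact ⟨x :: p, hp, hfilter⟩
end

section
/- (Soundness of one transitive-reduction step in Algorithm 1.) Let R be a relation on a type α, let u v : α with R u v, and let R' be R with the single pair (u, v) removed, i.e., R' a b ↔ R a b ∧ ¬(a = u ∧ b = v). If there is an alternative path from u to v avoiding this edge, i.e., Relation.TransGen R' u v, then removing the edge preserves reachability: Relation.ReflTransGen R' = Relation.ReflTransGen R. -/
/-- Soundness of one transitive-reduction step: removing an edge
`(u, v)` that has an alternative `R'`-path from `u` to `v` preserves
reachability. -/
theorem stmt8 {α : Type*} (R : α → α → Prop) (u v : α) (huv : R u v)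
    (R' : α → α → Prop)
    (hR' : ∀ a b, R' a b ↔ R a b ∧ ¬(a = u ∧ b = v))
    (halt : Relation.TransGen R' u v) :
    Relation.ReflTransGen R' = Relation.ReflTransGen R := by
  refine le_antisymm (Relation.ReflTransGen.mono fun a b h => ((hR' a b).1 h).1) fun a b h => ?_
  induction h with
  | refl => exact .refl
  | @tail c d _ hcd ih =>
    by_cases huv_eq : c = u ∧ d = v
    · obtain ⟨rfl, rfl⟩ := huv_eq
      exact ih.trans halt.to_reflTransGen
    · exact ih.tail ((hR' c d).2 ⟨hcd, huv_eq⟩)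
end

section
/- (Termination/result of the edge-removal loop of Algorithm 1.) Let α be a finite type with decidable equality and R a relation on α. Then there exists an irredundant transitive reduction of R: a relation R' with R' ≤ R, Relation.ReflTransGen R' = Relation.ReflTransGen R, and for all u v with R' u v there is no Relation.TransGen path from u to v in the relation obtained from R' by removing the single pair (u, v). -/
/-- Removing a pair that is bypassed by the remaining pairs preserves the reflexive transitive
closure. -/
theorem reflTransGen_remove_pair_eq {α : Type*} {R : α → α → Prop} {u v : α}
    (h : Relation.TransGen (fun a b => R a b ∧ ¬(a = u ∧ b = v)) u v) :
    Relation.ReflTransGen (fun a b => R a b ∧ ¬(a = u ∧ b = v)) = Relation.ReflTransGen R := by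
  refine le_antisymm (Relation.reflTransGen_closed fun a b hab => .single hab.1)
    (Relation.reflTransGen_closed fun a b hab => ?_)
  by_cases huv : a = u ∧ b = v
  · obtain ⟨rfl, rfl⟩ := huv
    exact h.to_reflTransGen
  · exact .single ⟨hab, huv⟩

/-- Termination/result of the edge-removal loop: on a finite type,
every relation has an irredundant transitive reduction. -/
theorem stmt9 {α : Type*} [Fintype α] [DecidableEq α] (R : α → α → Prop) :
    ∃ R' : α → α → Prop, R' ≤ R ∧
      Relation.ReflTransGen R' = Relation.ReflTransGen R ∧
      ∀ u v, R' u v →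
        ¬ Relation.TransGen (fun a b => R' a b ∧ ¬(a = u ∧ b = v)) u v := by
  obtain ⟨R', hle, hmin⟩ := exists_minimal_le_of_wellFoundedLT
    (fun S : α → α → Prop => Relation.ReflTransGen S = Relation.ReflTransGen R) R rfl
  refine ⟨R', hle, hmin.prop, fun u v huv hpath => ?_⟩
  exact (hmin.le_of_le ((reflTransGen_remove_pair_eq hpath).trans hmin.prop)
    (fun a b hab => hab.1) u v huv).2 ⟨rfl, rfl⟩
end

section
/- (Uniqueness of the transitive reduction of a finite DAG.) Let α be a finite type and R a relation on α whose transitive closure S := Relation.TransGen R is irreflexive. Let R' be any irredundant transitive reduction of R. Then R' equals the covering relation of S: for all a b, R' a b ↔ (S a b ∧ ¬∃ c, S a c ∧ S c b). In particular, the output of the transitive-reduction phase of Algorithm 1 is independent of the order in which removable edges are processed. -/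
/-- A path either avoids the edge from `u` to `v` or decomposes through it. -/
theorem Relation.TransGen.avoid_edge_or {α : Type*} {r : α → α → Prop} {x y : α}
    (hxy : Relation.TransGen r x y) (u v : α) :
    Relation.TransGen (fun a b => r a b ∧ ¬(a = u ∧ b = v)) x y ∨
      (Relation.ReflTransGen r x u ∧ Relation.ReflTransGen r v y) := by
  induction hxy with
  | @single b hb =>
    by_cases huv : x = u ∧ b = v
    · obtain ⟨rfl, rfl⟩ := huv
      exact .inr ⟨.refl, .refl⟩
    · exact .inl (.single ⟨hb, huv⟩)
  | @tail b c hab hbc ih =>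
    rcases ih with ih | ⟨hxu, hvb⟩
    · by_cases huv : b = u ∧ c = v
      · obtain ⟨rfl, rfl⟩ := huv
        exact .inr ⟨hab.to_reflTransGen, .refl⟩
      · exact .inl (ih.tail ⟨hbc, huv⟩)
    · exact .inr ⟨hxu, hvb.tail hbc⟩

/-- Uniqueness of the transitive reduction of a finite DAG:
any irredundant transitive reduction of `R` equals the covering relation of
`S := Relation.TransGen R`. -/
theorem stmt11 {α : Type*} [Fintype α] (R : α → α → Prop)
    (h : Irreflexive (Relation.TransGen R))
    (R' : α → α → Prop) (hle : R' ≤ R)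
    (hcl : Relation.ReflTransGen R' = Relation.ReflTransGen R)
    (hirr : ∀ u v, R' u v →
      ¬ Relation.TransGen (fun a b => R' a b ∧ ¬(a = u ∧ b = v)) u v) :
    ∀ a b, R' a b ↔
      (Relation.TransGen R a b ∧
        ¬ ∃ c, Relation.TransGen R a c ∧ Relation.TransGen R c b) := by
  have hS : Relation.TransGen R = Relation.TransGen R' := by
    ext a b
    refine ⟨fun hab => ?_, Relation.TransGen.mono hle a b⟩
    have hab' : Relation.ReflTransGen R' a b := hcl ▸ hab.to_reflTransGen
    rcases Relation.reflTransGen_iff_eq_or_transGen.1 hab' with rfl | hab'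
    · exact absurd hab (h b)
    · exact hab'
  rw [hS] at h ⊢
  refine fun a b => ⟨fun hab => ⟨.single hab, ?_⟩, ?_⟩
  · rintro ⟨c, hac, hcb⟩
    rcases hac.avoid_edge_or a b with hac' | ⟨-, hbc⟩
    · rcases hcb.avoid_edge_or a b with hcb' | ⟨hca, -⟩
      · exact hirr a b hab (hac'.trans hcb')
      · exact h a (hac.trans_left hca)
    · exact h c (hcb.trans_left hbc)
  · rintro ⟨hab, hno⟩
    rcases Relation.TransGen.tail'_iff.1 hab with ⟨c, hac, hcb⟩
    rcases Relation.reflTransGen_iff_eq_or_transGen.1 hac with rfl | hac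
    · exact hcb
    · exact absurd ⟨c, hac, .single hcb⟩ hno
end

section
/- (A single agent's diagram is the chain of its trace.) Let L : List α be a list with no duplicate entries, and let R_L be the relation defined by R_L a b iff [a, b] occurs as a contiguous sublist (infix) of L. Then for all a b, Relation.TransGen R_L a b holds iff a appears before b in L. -/
theorem List.Nodup.append_cons_inj {α : Type*} {b : α} {s t s' t' : List α}
    (hn : (s ++ b :: t).Nodup) (h : s ++ b :: t = s' ++ b :: t') : s = s' ∧ t = t' := by
  induction s generalizing s' with
  | nil => cases s' <;> grind
  | cons x s ih => cases s' <;> grind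

theorem List.transGen_infix_append_cons {α : Type*} (l₁ : List α) (a : α) (l₂ : List α) (b : α)
    (l₃ : List α) :
    Relation.TransGen (fun x y => [x, y] <:+: l₁ ++ a :: l₂ ++ b :: l₃) a b := by
  induction l₂ generalizing l₁ a with
  | nil => exact .single ⟨l₁, l₃, by simp⟩
  | cons c l₂ ih =>
    refine .head (b := c) ⟨l₁, l₂ ++ b :: l₃, by simp⟩ ?_
    simpa using ih (l₁ ++ [a]) c

/-- A single agent's diagram is the chain of its trace: for a
nodup list `L`, the transitive closure of the consecutive-pair relation of `L`
coincides with the appears-before relation of `L`. -/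
theorem stmt12 {α : Type*} [DecidableEq α] (L : List α) (hL : L.Nodup)
    (a b : α) :
    Relation.TransGen (fun x y => [x, y] <:+: L) a b ↔
      ∃ l₁ l₂ l₃, L = l₁ ++ a :: l₂ ++ b :: l₃ := by
  constructor
  · intro h
    induction h with
    | single h =>
      obtain ⟨s, t, rfl⟩ := h
      exact ⟨s, [], t, by simp⟩
    | @tail b c _ h ih =>
      obtain ⟨l₁, l₂, l₃, rfl⟩ := ih
      obtain ⟨s, t, h⟩ := h
      obtain ⟨-, rfl⟩ := hL.append_cons_inj (s' := s) (t' := c :: t) (by simp [← h])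
      exact ⟨l₁, l₂ ++ [b], t, by simp⟩
  · rintro ⟨l₁, l₂, l₃, rfl⟩
    exact List.transGen_infix_append_cons l₁ a l₂ b l₃
end

section
/- (The Hasse diagram of a single trace consists of its consecutive pairs.) Let L : List α be a list with no duplicate entries, and let S_L be the appears-before relation of L. Then the covering relation of S_L coincides with the consecutive-pair relation of L: for all a b, (S_L a b ∧ ¬∃ c, S_L a c ∧ S_L c b) holds iff the two-element list [a, b] occurs as a contiguous sublist (infix) of L. -/
theorem List.Nodup.append_cons_inj_s13 {α : Type*} {x : α} {p q p' q' : List α}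
    (hnd : (p ++ x :: q).Nodup) (h : p ++ x :: q = p' ++ x :: q') : p = p' ∧ q = q' := by
  have hp : x ∉ p := fun hx => List.disjoint_of_nodup_append hnd hx (by simp)
  have hp' : x ∉ p' := fun hx => List.disjoint_of_nodup_append (h ▸ hnd) hx (by simp)
  classical
  have hlen := congrArg (List.idxOf x) h
  rw [List.idxOf_append_of_notMem hp, List.idxOf_append_of_notMem hp'] at hlen
  simpa using List.append_inj h (by simpa using hlen)


/-- The Hasse diagram of a single trace consists of its
consecutive pairs: for a nodup list `L`, the covering relation of the
appears-before relation of `L` coincides with `[a, b]` being an infix of `L`. -/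
theorem stmt13 {α : Type*} [DecidableEq α] (L : List α) (hL : L.Nodup)
    (a b : α) :
    ((∃ l₁ l₂ l₃, L = l₁ ++ a :: l₂ ++ b :: l₃) ∧
        ¬ ∃ c, (∃ l₁ l₂ l₃, L = l₁ ++ a :: l₂ ++ c :: l₃) ∧
               (∃ l₁ l₂ l₃, L = l₁ ++ c :: l₂ ++ b :: l₃)) ↔
      [a, b] <:+: L := by
  constructor
  · rintro ⟨⟨l₁, l₂, l₃, rfl⟩, hcov⟩
    cases l₂ with
    | nil => exact ⟨l₁, l₃, by simp⟩
    | cons c t =>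
      exact absurd ⟨c, ⟨l₁, [], t ++ b :: l₃, by simp⟩, l₁ ++ [a], t, l₃, by simp⟩ hcov
  · rintro ⟨s, t, rfl⟩
    refine ⟨⟨s, [], t, by simp⟩, ?_⟩
    rintro ⟨c, ⟨m₁, m₂, m₃, hac⟩, n₁, n₂, n₃, hcb⟩
    have hbt : b :: t = m₂ ++ c :: m₃ :=
      (List.Nodup.append_cons_inj_s13 (x := a) (p := s) (by simpa using hL) (by simpa using hac)).2
    have hsa : s ++ [a] = n₁ ++ c :: n₂ :=
      (List.Nodup.append_cons_inj_s13 (x := b) (q := t) (by simpa using hL) (by simpa using hcb)).1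
    have hnd : ((s ++ [a]) ++ b :: t).Nodup := by simpa using hL
    exact List.disjoint_of_nodup_append hnd (a := c) (by simp [hsa]) (by simp [hbt])
end
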